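/- For every CCS process P ∈ P_CCS: χmay_𝓛(δ_P) = 1 if P is observable (P⇓) and χmay_𝓛(δ_P) = 0 otherwise; and χfair_𝓛(δ_P) = 1 if P is strongly observable (P⇊) and χfair_𝓛(δ_P) = 0 otherwise. -/

import Mathlib

open scoped Classical

/-! ## Channels, actions, RCCS terms -/

/-- Channels, drawn from an infinite set. -/
abbrev Chan := ℕ

/-- Actions: input/output labels over channels, the silent action `τ`, and the
distinguished success action `ω` (used only by observers). -/
inductive Act where
  | inp : Chan → Act
  | out : Chan → Act
  | tau : Act
  | omega : Act
deriving DecidableEq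

/-- `α` is an external label, i.e. a member of `𝓛 = N ∪ N̄`. -/
def Act.IsLabel : Act → Prop
  | .inp _ => True
  | .out _ => True
  | _ => False

/-- Complementary labels (for communication). -/
def Act.Comp : Act → Act → Prop := fun x y =>
  ∃ a, (x = .inp a ∧ y = .out a) ∨ (x = .out a ∧ y = .inp a)

/-- `β, β̄ ∉ L`: the action is not blocked by the localization `(L)-`. -/
def Act.Allowed (L : Finset Chan) : Act → Prop
  | .inp a => a ∉ L
  | .out a => a ∉ L
  | _ => True

/-- Channels occurring in an action. -/
def Act.chans : Act → Finset Chan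
  | .inp a => {a}
  | .out a => {a}
  | _ => ∅

/-- RCCS (and RCCS^ω) terms, with de Bruijn indices for process variables.
`sum k acts conts` is the nondeterministic choice `Σ_{i∈I} α_i.T_i` over the
nonempty finite index set `I = Fin (k+1)`, and `oplus k w conts` is the
probabilistic choice `⊕_{i∈I} p_i τ.T_i`. `fix T` is `μX.T` (binding index 0). -/
inductive Tm where
  | nil : Tm
  | var : ℕ → Tm
  | sum : (k : ℕ) → (Fin (k+1) → Act) → (Fin (k+1) → Tm) → Tm
  | oplus : (k : ℕ) → (Fin (k+1) → ℝ) → (Fin (k+1) → Tm) → Tm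
  | par : Tm → Tm → Tm
  | loc : Finset Chan → Tm → Tm
  | fix : Tm → Tm

/-- Substitution `T{P/X}` of a (closed) term `P` for the de Bruijn variable `n`. -/
def Tm.subst (P : Tm) : ℕ → Tm → Tm
  | _, .nil => .nil
  | n, .var m => if m = n then P else .var m
  | n, .sum k a c => .sum k a (fun i => Tm.subst P n (c i))
  | n, .oplus k w c => .oplus k w (fun i => Tm.subst P n (c i))
  | n, .par S T => .par (Tm.subst P n S) (Tm.subst P n T)
  | n, .loc L T => .loc L (Tm.subst P n T)
  | n, .fix T => .fix (Tm.subst P (n+1) T)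

/-- `T` has all its free variables among the first `n` de Bruijn indices.
`ClosedAt 0 T` means `T` is closed; `ClosedAt 1 T` means at most one free variable. -/
def Tm.ClosedAt : ℕ → Tm → Prop
  | _, .nil => True
  | n, .var m => m < n
  | n, .sum _ _ c => ∀ i, Tm.ClosedAt n (c i)
  | n, .oplus _ _ c => ∀ i, Tm.ClosedAt n (c i)
  | n, .par S T => Tm.ClosedAt n S ∧ Tm.ClosedAt n T
  | n, .loc _ T => Tm.ClosedAt n T
  | n, .fix T => Tm.ClosedAt (n+1) T

/-- The success action `ω` does not occur in `T` (so `T` is a genuine RCCS term). -/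
def Tm.NoOmega : Tm → Prop
  | .nil => True
  | .var _ => True
  | .sum _ a c => (∀ i, a i ≠ Act.omega) ∧ (∀ i, Tm.NoOmega (c i))
  | .oplus _ _ c => ∀ i, Tm.NoOmega (c i)
  | .par S T => Tm.NoOmega S ∧ Tm.NoOmega T
  | .loc _ T => Tm.NoOmega T
  | .fix T => Tm.NoOmega T

/-- No probabilistic choice occurs in `T` (so `T` is a CCS term). -/
def Tm.NoOplus : Tm → Prop
  | .nil => True
  | .var _ => True
  | .sum _ _ c => ∀ i, Tm.NoOplus (c i)
  | .oplus _ _ _ => False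
  | .par S T => Tm.NoOplus S ∧ Tm.NoOplus T
  | .loc _ T => Tm.NoOplus T
  | .fix T => Tm.NoOplus T

/-- The channels `N(T)` occurring in a term. -/
def Tm.chans : Tm → Finset Chan
  | .nil => ∅
  | .var _ => ∅
  | .sum _ a c =>
      (Finset.univ.sup fun i => (a i).chans) ∪ (Finset.univ.sup fun i => Tm.chans (c i))
  | .oplus _ _ c => Finset.univ.sup fun i => Tm.chans (c i)
  | .par S T => S.chans ∪ T.chans
  | .loc L T => L ∪ T.chans
  | .fix T => T.chans

/-- Renaming of channels in an action. -/
def Act.rename (f : Chan → Chan) : Act → Act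
  | .inp a => .inp (f a)
  | .out a => .out (f a)
  | x => x

/-- Renaming `T[f]` of the global channels of a term (local channels are untouched). -/
def Tm.rename : (Chan → Chan) → Tm → Tm
  | _, .nil => .nil
  | _, .var m => .var m
  | f, .sum k a c => .sum k (fun i => (a i).rename f) (fun i => Tm.rename f (c i))
  | f, .oplus k w c => .oplus k w (fun i => Tm.rename f (c i))
  | f, .par S T => .par (Tm.rename f S) (Tm.rename f T)
  | f, .loc L T => .loc L (Tm.rename (fun a => if a ∈ L then a else f a) T)
  | f, .fix T => .fix (Tm.rename f T)

/-- `P` is an RCCS process: closed and without the success action. -/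
def Tm.IsProc (P : Tm) : Prop := Tm.ClosedAt 0 P ∧ Tm.NoOmega P

/-- `P` is a CCS process: a process without probabilistic choice. -/
def Tm.IsCCS (P : Tm) : Prop := P.IsProc ∧ Tm.NoOplus P

/-! ## Finitely supported distributions -/

/-- Finitely supported probability distributions on `α`. -/
structure FinDist (α : Type) where
  toFun : α → ℝ
  nonneg : ∀ a, 0 ≤ toFun a
  finite_support : (Function.support toFun).Finite
  sum_one : ∑ᶠ a, toFun a = 1

namespace FinDist

/-- The probability `μ(φ)` that a predicate (set) `φ` holds under `μ`. -/
noncomputable def mass {α : Type} (μ : FinDist α) (φ : Set α) : ℝ :=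
  ∑ᶠ a ∈ φ, μ.toFun a

/-- The Dirac distribution `δ_P`. -/
noncomputable def dirac {α : Type} (P : α) : FinDist α where
  toFun := fun Q => if Q = P then 1 else 0
  nonneg := by intro a; by_cases h : a = P <;> simp [h]
  finite_support := by
    apply Set.Finite.subset (Set.finite_singleton P)
    intro a ha
    by_contra h
    simp only [Set.mem_singleton_iff] at h
    simp [Function.mem_support, h] at ha
  sum_one := by
    rw [finsum_eq_single _ P (fun b hb => by simp [hb])]
    simp

/-- Pushforward of a finitely supported distribution along a map. -/
noncomputable def map {α β : Type} (g : α → β) (μ : FinDist α) : FinDist β where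
  toFun := fun b => ∑ᶠ a ∈ {a | g a = b}, μ.toFun a
  nonneg := by
    intro b
    exact finsum_nonneg fun a => finsum_nonneg fun _ => μ.nonneg a
  finite_support := by
    apply Set.Finite.subset (μ.finite_support.image g)
    intro b hb
    rw [Function.mem_support] at hb
    by_contra h
    apply hb
    apply finsum_mem_eq_zero_of_forall_eq_zero
    intro a ha
    by_contra ha0
    exact h ⟨a, Function.mem_support.mpr ha0, ha⟩
  sum_one := by
    classical
    set s := μ.finite_support.toFinset with hs
    have hfib : ∀ b : β, (∑ᶠ a ∈ {a | g a = b}, μ.toFun a)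
        = ∑ a ∈ s.filter (fun a => g a = b), μ.toFun a := by
      intro b
      apply finsum_mem_eq_sum_of_inter_support_eq
      ext a
      simp only [Set.mem_inter_iff, Set.mem_setOf_eq, Finset.coe_filter,
        Set.Finite.mem_toFinset, Function.mem_support, hs]
      tauto
    have hsub : Function.support (fun b : β => ∑ᶠ a ∈ {a | g a = b}, μ.toFun a) ⊆
        ↑(s.image g) := by
      intro b hb
      rw [Function.mem_support, hfib] at hb
      obtain ⟨a, ha, hne⟩ := Finset.exists_ne_zero_of_sum_ne_zero hb
      rw [Finset.mem_filter] at ha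
      simp only [Finset.coe_image, Set.mem_image, Finset.mem_coe]
      exact ⟨a, ha.1, ha.2⟩
    rw [finsum_eq_finset_sum_of_support_subset _ hsub]
    calc ∑ b ∈ s.image g, ∑ᶠ a ∈ {a | g a = b}, μ.toFun a
        = ∑ b ∈ s.image g, ∑ a ∈ s.filter (fun a => g a = b), μ.toFun a :=
          Finset.sum_congr rfl fun b _ => hfib b
      _ = ∑ a ∈ s, μ.toFun a :=
          Finset.sum_fiberwise_of_maps_to (fun a ha => Finset.mem_image_of_mem g ha)
            μ.toFun
      _ = 1 := by rw [← finsum_eq_sum μ.toFun μ.finite_support]; exact μ.sum_one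

/-- The product of two finitely supported distributions. -/
noncomputable def prod {α β : Type} (μ : FinDist α) (ν : FinDist β) :
    FinDist (α × β) where
  toFun := fun x => μ.toFun x.1 * ν.toFun x.2
  nonneg := fun x => mul_nonneg (μ.nonneg _) (ν.nonneg _)
  finite_support := by
    apply Set.Finite.subset (μ.finite_support.prod ν.finite_support)
    intro x hx
    rw [Function.mem_support] at hx
    have h := mul_ne_zero_iff.mp hx
    exact ⟨Function.mem_support.mpr h.1, Function.mem_support.mpr h.2⟩
  sum_one := by
    classical
    have hsub : Function.support (fun x : α × β => μ.toFun x.1 * ν.toFun x.2) ⊆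
        ↑(μ.finite_support.toFinset ×ˢ ν.finite_support.toFinset) := by
      intro x hx
      rw [Function.mem_support] at hx
      have h := mul_ne_zero_iff.mp hx
      simp only [Finset.coe_product, Set.mem_prod, Set.Finite.coe_toFinset]
      exact ⟨h.1, h.2⟩
    rw [finsum_eq_finset_sum_of_support_subset _ hsub, Finset.sum_product]
    have h1 : ∑ a ∈ μ.finite_support.toFinset, μ.toFun a = 1 := by
      rw [← finsum_eq_sum μ.toFun μ.finite_support]; exact μ.sum_one
    have h2 : ∑ b ∈ ν.finite_support.toFinset, ν.toFun b = 1 := by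
      rw [← finsum_eq_sum ν.toFun ν.finite_support]; exact ν.sum_one
    calc ∑ a ∈ μ.finite_support.toFinset, ∑ b ∈ ν.finite_support.toFinset,
          μ.toFun a * ν.toFun b
        = ∑ a ∈ μ.finite_support.toFinset, μ.toFun a * 1 := by
          refine Finset.sum_congr rfl fun a _ => ?_
          rw [← Finset.mul_sum, h2]
      _ = 1 := by simpa using h1

/-- Parallel composition `μ | ν` of distributions:
`(μ|ν)(A|B) = μ(A)·ν(B)`. -/
noncomputable def parD (μ ν : FinDist Tm) : FinDist Tm :=
  (μ.prod ν).map fun x => Tm.par x.1 x.2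

/-- Localization `(L)μ` of a distribution. -/
noncomputable def locD (L : Finset Chan) (μ : FinDist Tm) : FinDist Tm :=
  μ.map (Tm.loc L)

/-- Renaming `μ[f]` of a distribution. -/
noncomputable def renameD (f : Chan → Chan) (μ : FinDist Tm) : FinDist Tm :=
  μ.map (Tm.rename f)

/-- Instantiation `ϑ[P]` of a 1-ary distribution `ϑ` at the process `P`. -/
noncomputable def instD (ϑ : FinDist Tm) (P : Tm) : FinDist Tm :=
  ϑ.map (fun T => Tm.subst P 0 T)

/-- Every element of the support is a process (`μ ∈ D(P_RCCS)`). -/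
def IsProcDist (μ : FinDist Tm) : Prop := ∀ P, μ.toFun P ≠ 0 → P.IsProc

/-- All channels occurring in (the support of) `μ` lie in `L`. -/
def chansIn (μ : FinDist Tm) (L : Finset Chan) : Prop :=
  ∀ P, μ.toFun P ≠ 0 → P.chans ⊆ L

/-- The channel `a` occurs in (the support of) `μ`, i.e. `a ∈ N(μ)`. -/
def hasChan (μ : FinDist Tm) (a : Chan) : Prop := ∃ P, μ.toFun P ≠ 0 ∧ a ∈ P.chans

end FinDist

/-! ## Part I: the probabilistic labelled transition system on processes -/

/-- Part I of the pLTS for RCCS (and RCCS^ω): `P →α ρ`. -/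
inductive Step : Tm → Act → FinDist Tm → Prop where
  | choice {k : ℕ} (acts : Fin (k+1) → Act) (conts : Fin (k+1) → Tm) (i : Fin (k+1)) :
      Step (.sum k acts conts) (acts i) (FinDist.dirac (conts i))
  | oplus {k : ℕ} (w : Fin (k+1) → ℝ) (conts : Fin (k+1) → Tm) (ρ : FinDist Tm) :
      (∀ i, 0 < w i ∧ w i < 1) →
      (∀ Q, ρ.toFun Q = ∑ i, if conts i = Q then w i else 0) →
      Step (.oplus k w conts) .tau ρ
  | parL {S : Tm} {α : Act} {ρ : FinDist Tm} (T : Tm) :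
      Step S α ρ → Step (.par S T) α (ρ.parD (FinDist.dirac T))
  | parR {T : Tm} {α : Act} {ρ : FinDist Tm} (S : Tm) :
      Step T α ρ → Step (.par S T) α ((FinDist.dirac S).parD ρ)
  | comm {S T : Tm} {ℓ1 ℓ2 : Act} {ρ1 ρ2 : FinDist Tm} :
      Act.Comp ℓ1 ℓ2 → Step S ℓ1 ρ1 → Step T ℓ2 ρ2 →
      Step (.par S T) .tau (ρ1.parD ρ2)
  | loc {T : Tm} {β : Act} {ρ : FinDist Tm} (L : Finset Chan) :
      Step T β ρ → Act.Allowed L β → Step (.loc L T) β (FinDist.locD L ρ)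
  | fixp {T : Tm} {β : Act} {ρ : FinDist Tm} :
      Step (Tm.subst (.fix T) 0 T) β ρ → Step (.fix T) β ρ

/-! ## Part II: probabilistic transitions on distributions -/

/-- Part II of the pLTS: `μ →(α,p) ν` iff `0 < p ≤ 1` and there are `P ∈ supp μ`
and `ρ` with `P →α ρ` and `ν = μ + μ(P)·p·(ρ − δ_P)`. -/
def PStep (μ : FinDist Tm) (α : Act) (p : ℝ) (ν : FinDist Tm) : Prop :=
  0 < p ∧ p ≤ 1 ∧
    ∃ P ρ, 0 < μ.toFun P ∧ Step P α ρ ∧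
      ∀ Q, ν.toFun Q = μ.toFun Q + μ.toFun P * p * (ρ.toFun Q - (if Q = P then 1 else 0))

/-- Probabilistic transition sequence `μ →π ν` along a word `π`. -/
def PSeq : FinDist Tm → List (Act × ℝ) → FinDist Tm → Prop
  | μ, [], ν => ν = μ
  | μ, s :: π, ν => ∃ μ', PStep μ s.1 s.2 μ' ∧ PSeq μ' π ν

/-- Internal transition sequence `μ ⇝ ν`. -/
def Internal (μ ν : FinDist Tm) : Prop :=
  ∃ π : List (Act × ℝ), (∀ s ∈ π, s.1 = Act.tau) ∧ PSeq μ π ν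

/-! ## Observability predicates and testing characteristics -/

/-- `ψ_𝓛`: processes that can immediately perform an external action. -/
def psiL : Set Tm := {P | ∃ α ρ, Act.IsLabel α ∧ Step P α ρ}

/-- `ψ_ω`: processes that can immediately perform the success action `ω`. -/
def psiOmega : Set Tm := {P | ∃ ρ, Step P Act.omega ρ}

/-- The may characteristic `χmay_𝓛(μ) = sup { ν(ψ_𝓛) : μ ⇝ ν }`. -/
noncomputable def chiMayL (μ : FinDist Tm) : ℝ :=
  sSup {x | ∃ ν, Internal μ ν ∧ x = ν.mass psiL}

/-- The fair characteristic `χfair_𝓛(μ) = inf { χmay_𝓛(ν) : μ ⇝ ν }`. -/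
noncomputable def chiFairL (μ : FinDist Tm) : ℝ :=
  sInf {x | ∃ ν, Internal μ ν ∧ x = chiMayL ν}

/-- `χmay_ω(μ) = sup { ν(ψ_ω) : μ ⇝ ν }`. -/
noncomputable def chiMayOmega (μ : FinDist Tm) : ℝ :=
  sSup {x | ∃ ν, Internal μ ν ∧ x = ν.mass psiOmega}

/-- `χfair_ω(μ) = inf { χmay_ω(ν) : μ ⇝ ν }`. -/
noncomputable def chiFairOmega (μ : FinDist Tm) : ℝ :=
  sInf {x | ∃ ν, Internal μ ν ∧ x = chiMayOmega ν}

/-! ## Testing contexts, equipollence, extensionality, diamond/box equivalences -/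

/-- `Δ(P_CCS) ⊆ 𝒟 ⊆ D(P_RCCS)`, closed under parallel composition, localization
and (finite-domain) renaming. -/
structure IsTestingContext (D : Set (FinDist Tm)) : Prop where
  dirac_ccs : ∀ P : Tm, P.IsCCS → FinDist.dirac P ∈ D
  proc_dist : ∀ μ ∈ D, μ.IsProcDist
  closed_par : ∀ μ ∈ D, ∀ ν ∈ D, μ.parD ν ∈ D
  closed_loc : ∀ μ ∈ D, ∀ L : Finset Chan, FinDist.locD L μ ∈ D
  closed_rename : ∀ μ ∈ D, ∀ f : Chan → Chan, {a | f a ≠ a}.Finite →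
      FinDist.renameD f μ ∈ D

/-- `R` is probabilistically equipollent. -/
def Equipollent (R : FinDist Tm → FinDist Tm → Prop) : Prop :=
  ∀ μ1 μ2, R μ1 μ2 → chiMayL μ1 = chiMayL μ2

/-- `R` is probabilistically strongly equipollent. -/
def StronglyEquipollent (R : FinDist Tm → FinDist Tm → Prop) : Prop :=
  ∀ μ1 μ2, R μ1 μ2 → chiFairL μ1 = chiFairL μ2

/-- `R` is `𝒟`-extensional. -/
def DExtensional (D : Set (FinDist Tm)) (R : FinDist Tm → FinDist Tm → Prop) : Prop :=
  ∀ μ1 μ2, R μ1 μ2 →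
    (∀ ν ∈ D, R (μ1.parD ν) (μ2.parD ν)) ∧
    (∀ L : Finset Chan, R (FinDist.locD L μ1) (FinDist.locD L μ2))

/-- The `𝒟`-diamond equivalence `=◇^𝒟`, the largest probabilistically equipollent
`𝒟`-extensional relation. -/
def DiamondEq (D : Set (FinDist Tm)) (μ1 μ2 : FinDist Tm) : Prop :=
  ∃ R, Equipollent R ∧ DExtensional D R ∧ R μ1 μ2

/-- The `𝒟`-box equivalence `=□^𝒟`, the largest probabilistically strongly
equipollent `𝒟`-extensional relation. -/
def BoxEq (D : Set (FinDist Tm)) (μ1 μ2 : FinDist Tm) : Prop :=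
  ∃ R, StronglyEquipollent R ∧ DExtensional D R ∧ R μ1 μ2

/-! ## Probabilistic strong bisimulation and lifting -/

/-- Lifting of a relation on processes to distributions, matching the decomposition
`ρ1 = Σ_i p_i δ_{A_i}`, `ρ2 = Σ_i p_i δ_{B_i}` with `A_i R B_i`. -/
def RelLift (R : Tm → Tm → Prop) (ρ1 ρ2 : FinDist Tm) : Prop :=
  ∃ (k : ℕ) (p : Fin (k+1) → ℝ) (A B : Fin (k+1) → Tm),
    (∀ i, 0 ≤ p i) ∧
    (∀ Q, ρ1.toFun Q = ∑ i, if A i = Q then p i else 0) ∧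
    (∀ Q, ρ2.toFun Q = ∑ i, if B i = Q then p i else 0) ∧
    (∀ i, R (A i) (B i))

/-- `R` is a probabilistic strong bisimulation. -/
def IsStrongBisim (R : Tm → Tm → Prop) : Prop :=
  ∀ P Q, R P Q →
    (∀ α ρ, Step P α ρ → ∃ ρ', Step Q α ρ' ∧ RelLift R ρ ρ') ∧
    (∀ α ρ, Step Q α ρ → ∃ ρ', Step P α ρ' ∧ RelLift R ρ ρ')

/-- `∼p`, the largest probabilistic strong bisimulation. -/
def StrongBisim (P Q : Tm) : Prop := ∃ R, IsStrongBisim R ∧ R P Q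

/-- Lifting `E†` of an equivalence on processes to distributions: agreement on the
mass of every equivalence class. -/
def EqLift (E : Tm → Tm → Prop) (μ1 μ2 : FinDist Tm) : Prop :=
  ∀ P, μ1.mass {Q | E P Q} = μ2.mass {Q | E P Q}

/-- Transitions of CCS processes go to Dirac distributions: write `P →α P'` for
`P →α δ_{P'}`. -/
def CStep (P : Tm) (α : Act) (Q : Tm) : Prop := Step P α (FinDist.dirac Q)

/-- `P ⟹ P'`: the reflexive transitive closure of `→τ` on processes. -/
def TauSeq : Tm → Tm → Prop :=
  Relation.ReflTransGen (fun P Q => CStep P Act.tau Q)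

/-- `P⇓`: `P` is observable. -/
def Observable (P : Tm) : Prop := ∃ Q, TauSeq P Q ∧ Q ∈ psiL

/-- `P⇊`: `P` is strongly observable. -/
def StronglyObservable (P : Tm) : Prop := ∀ Q, TauSeq P Q → Observable Q

theorem FinDist.ext' {α : Type} {μ ν : FinDist α} (h : ∀ a, μ.toFun a = ν.toFun a) : μ = ν := by
  cases μ; cases ν
  simp only [FinDist.mk.injEq]
  exact funext h

theorem FinDist.dirac_apply {α : Type} (P Q : α) :
    (FinDist.dirac P).toFun Q = if Q = P then 1 else 0 := rfl

theorem FinDist.map_dirac {α β : Type} (g : α → β) (P : α) :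
    (FinDist.dirac P).map g = FinDist.dirac (g P) := by
  apply FinDist.ext'
  intro b
  show (∑ᶠ a ∈ {a | g a = b}, (FinDist.dirac P).toFun a) = _
  rw [finsum_mem_def, finsum_eq_single _ P]
  · by_cases h : g P = b
    · simp [Set.indicator, FinDist.dirac_apply, h]
    · simp [Set.indicator, FinDist.dirac_apply, h, Ne.symm h]
  · intro x hx
    simp [Set.indicator, FinDist.dirac_apply, hx]

theorem FinDist.prod_dirac {α β : Type} (P : α) (Q : β) :
    (FinDist.dirac P).prod (FinDist.dirac Q) = FinDist.dirac (P, Q) := by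
  apply FinDist.ext'
  rintro ⟨a, b⟩
  show (FinDist.dirac P).toFun a * (FinDist.dirac Q).toFun b = _
  simp only [FinDist.dirac_apply, Prod.mk.injEq]
  by_cases h1 : a = P <;> by_cases h2 : b = Q <;> simp [h1, h2]

theorem FinDist.parD_dirac (P Q : Tm) :
    (FinDist.dirac P).parD (FinDist.dirac Q) = FinDist.dirac (.par P Q) := by
  simp only [FinDist.parD, FinDist.prod_dirac, FinDist.map_dirac]

theorem FinDist.locD_dirac (L : Finset Chan) (P : Tm) :
    FinDist.locD L (FinDist.dirac P) = FinDist.dirac (.loc L P) := by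
  simp only [FinDist.locD, FinDist.map_dirac]

theorem Tm.NoOplus_subst {P : Tm} (hP : P.NoOplus) (T : Tm) :
    ∀ n, T.NoOplus → (Tm.subst P n T).NoOplus := by
  induction T with
  | nil => intro n h; exact h
  | var m => intro n h; simp only [Tm.subst]; split_ifs <;> assumption
  | sum k a c ih => intro n h i; exact ih i n (h i)
  | oplus k w c ih => intro n h; exact h.elim
  | par S T ihS ihT => intro n h; exact ⟨ihS n h.1, ihT n h.2⟩
  | loc L T ih => intro n h; exact ih n h
  | fix T ih => intro n h; exact ih (n+1) h

theorem step_ccs {P : Tm} {α : Act} {ρ : FinDist Tm} (h : Step P α ρ) :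
    P.NoOplus → ∃ Q : Tm, Q.NoOplus ∧ ρ = FinDist.dirac Q := by
  induction h with
  | choice acts conts i => intro h; exact ⟨_, h i, rfl⟩
  | oplus => intro h; exact h.elim
  | parL T _ ih =>
    intro h
    obtain ⟨Q, hQ, rfl⟩ := ih h.1
    exact ⟨Tm.par _ _, ⟨hQ, h.2⟩, FinDist.parD_dirac _ _⟩
  | parR S _ ih =>
    intro h
    obtain ⟨Q, hQ, rfl⟩ := ih h.2
    exact ⟨Tm.par _ _, ⟨h.1, hQ⟩, FinDist.parD_dirac _ _⟩
  | comm _ _ _ ih1 ih2 =>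
    intro h
    obtain ⟨Q, hQ, rfl⟩ := ih1 h.1
    obtain ⟨R, hR, rfl⟩ := ih2 h.2
    exact ⟨Tm.par _ _, ⟨hQ, hR⟩, FinDist.parD_dirac _ _⟩
  | loc L _ _ ih =>
    intro h
    obtain ⟨Q, hQ, rfl⟩ := ih h
    exact ⟨Tm.loc L Q, hQ, FinDist.locD_dirac _ _⟩
  | @fixp T β ρ _ ih =>
    intro h
    have hf : (Tm.fix T).NoOplus := h
    exact ih (Tm.NoOplus_subst hf T 0 h)

theorem dirac_inj {P Q : Tm} (h : FinDist.dirac P = FinDist.dirac Q) : P = Q := by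
  have := congrArg (fun μ => μ.toFun P) h
  simp only [FinDist.dirac_apply] at this
  by_contra hne
  simp [hne] at this

theorem tauSeq_noOplus {P Q : Tm} (hP : P.NoOplus) (h : TauSeq P Q) : Q.NoOplus := by
  induction h with
  | refl => exact hP
  | tail _ h2 ih =>
    obtain ⟨R, hR, he⟩ := step_ccs h2 ih
    rw [dirac_inj he]; exact hR

/-- All the support of `μ` is CCS and reachable from `P`. -/
def Reach (P : Tm) (μ : FinDist Tm) : Prop := ∀ Q, μ.toFun Q ≠ 0 → TauSeq P Q

theorem reach_step {P : Tm} (hP : P.NoOplus) {μ ν : FinDist Tm} {p : ℝ} (h : Reach P μ)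
    (hs : PStep μ Act.tau p ν) : Reach P ν := by
  obtain ⟨_, _, R, ρ, hR, hst, hν⟩ := hs
  have hPR := h R hR.ne'
  obtain ⟨R', _, rfl⟩ := step_ccs hst (tauSeq_noOplus hP hPR)
  intro Q hQ
  by_cases hQR' : Q = R'
  · subst hQR'
    exact Relation.ReflTransGen.tail hPR hst
  · by_cases hQR : Q = R
    · subst hQR; exact hPR
    · apply h
      rw [hν, FinDist.dirac_apply] at hQ
      simpa [hQR, hQR'] using hQ

theorem reach_internal {P : Tm} (hP : P.NoOplus) {μ ν : FinDist Tm} (h : Reach P μ)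
    (hs : Internal μ ν) : Reach P ν := by
  obtain ⟨π, hπ, hs⟩ := hs
  induction π generalizing μ with
  | nil => rw [show ν = μ from hs]; exact h
  | cons s π ih =>
    obtain ⟨μ', h1, h2⟩ := hs
    have : s.1 = Act.tau := hπ s (by simp)
    rw [this] at h1
    exact ih (reach_step hP h h1) (fun t ht => hπ t (by simp [ht])) h2

theorem reach_dirac (P : Tm) : Reach P (FinDist.dirac P) := by
  intro Q hQ
  rw [FinDist.dirac_apply] at hQ
  have : Q = P := by by_contra h; simp [h] at hQ
  subst this
  exact Relation.ReflTransGen.refl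

theorem internal_refl (μ : FinDist Tm) : Internal μ μ := ⟨[], by simp, rfl⟩

theorem internal_head {μ ν κ : FinDist Tm} {p : ℝ} (h : PStep μ Act.tau p ν)
    (h2 : Internal ν κ) : Internal μ κ := by
  obtain ⟨π, hπ, hs⟩ := h2
  refine ⟨(Act.tau, p) :: π, ?_, ν, h, hs⟩
  intro s hs
  rcases List.mem_cons.1 hs with rfl | hs
  · rfl
  · exact hπ s hs

theorem internal_trans {μ ν κ : FinDist Tm} (h : Internal μ ν)
    (h2 : Internal ν κ) : Internal μ κ := by
  obtain ⟨π, hπ, hs⟩ := h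
  induction π generalizing μ with
  | nil => rw [← show ν = μ from hs]; exact h2
  | cons s π ih =>
    obtain ⟨μ', h1, h3⟩ := hs
    have : s.1 = Act.tau := hπ s (by simp)
    rw [this] at h1
    exact internal_head h1 (ih (fun t ht => hπ t (by simp [ht])) h3)

theorem internal_dirac {P Q : Tm} (h : TauSeq P Q) :
    Internal (FinDist.dirac P) (FinDist.dirac Q) := by
  induction h using Relation.ReflTransGen.head_induction_on with
  | refl => exact internal_refl _
  | @head a c h1 _ ih =>
    refine internal_head (p := 1) ⟨one_pos, le_rfl, a, _, ?_, h1, ?_⟩ ih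
    · simp [FinDist.dirac_apply]
    · intro S
      simp [FinDist.dirac_apply]

theorem mass_eq_one {μ : FinDist Tm} {φ : Set Tm} (h : ∀ Q, μ.toFun Q ≠ 0 → Q ∈ φ) :
    μ.mass φ = 1 := by
  rw [← μ.sum_one, FinDist.mass, finsum_mem_def, Set.indicator_eq_self.2 h]

theorem mass_eq_zero {μ : FinDist Tm} {φ : Set Tm} (h : ∀ Q, μ.toFun Q ≠ 0 → Q ∉ φ) :
    μ.mass φ = 0 := by
  apply finsum_mem_eq_zero_of_forall_eq_zero
  intro x hx
  by_contra hne
  exact h x hne hx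

theorem mass_nonneg (μ : FinDist Tm) (φ : Set Tm) : 0 ≤ μ.mass φ :=
  finsum_nonneg fun a => finsum_nonneg fun _ => μ.nonneg a

theorem mass_le_one (μ : FinDist Tm) (φ : Set Tm) : μ.mass φ ≤ 1 := by
  rw [← μ.sum_one, FinDist.mass, finsum_mem_def]
  have hle : ∀ x, Set.indicator φ μ.toFun x ≤ μ.toFun x := fun x =>
    Set.indicator_le_self' (fun a _ => μ.nonneg a) x
  have hsub : Function.support (Set.indicator φ μ.toFun) ⊆ ↑μ.finite_support.toFinset := by
    intro x hx
    rw [Set.Finite.coe_toFinset]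
    exact fun hx0 => hx (by simp [Set.indicator, hx0])
  rw [finsum_eq_finsetSum_of_support_subset _ hsub, finsum_eq_sum μ.toFun μ.finite_support]
  exact Finset.sum_le_sum fun x _ => hle x

theorem chiMay_le_one (μ : FinDist Tm) : chiMayL μ ≤ 1 := by
  refine csSup_le ⟨μ.mass psiL, μ, internal_refl μ, rfl⟩ ?_
  rintro x ⟨ν, _, rfl⟩
  exact mass_le_one _ _

theorem chiMay_nonneg (μ : FinDist Tm) : 0 ≤ chiMayL μ := by
  apply Real.sSup_nonneg
  rintro x ⟨ν, _, rfl⟩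
  exact mass_nonneg _ _

theorem chiMay_eq_one {μ ν : FinDist Tm} (h : Internal μ ν)
    (h2 : ∀ Q, ν.toFun Q ≠ 0 → Q ∈ psiL) : chiMayL μ = 1 := by
  apply le_antisymm (chiMay_le_one μ)
  apply le_csSup
  · refine ⟨1, ?_⟩
    rintro x ⟨ν, _, rfl⟩
    exact mass_le_one _ _
  · exact ⟨ν, h, (mass_eq_one h2).symm⟩

theorem chiMay_eq_zero {P : Tm} (hP : P.NoOplus) (h : ¬ Observable P) :
    chiMayL (FinDist.dirac P) = 0 := by
  apply le_antisymm _ (chiMay_nonneg _)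
  refine csSup_le ⟨(FinDist.dirac P).mass psiL, _, internal_refl _, rfl⟩ ?_
  rintro x ⟨ν, hν, rfl⟩
  rw [mass_eq_zero]
  intro Q hQ hpsi
  exact h ⟨Q, reach_internal hP (reach_dirac P) hν Q hQ, hpsi⟩

/-- Move all the mass at `P` to `Q`. -/
theorem exists_move (μ : FinDist Tm) {P Q : Tm} (hPQ : P ≠ Q) : ∃ ν : FinDist Tm,
    ∀ S, ν.toFun S = μ.toFun S + μ.toFun P * 1 *
      ((FinDist.dirac Q).toFun S - (if S = P then 1 else 0)) := by
  have hfin : (Function.support fun S => μ.toFun P * (FinDist.dirac Q).toFun S).Finite :=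
    (FinDist.dirac Q).finite_support.subset fun x hx => right_ne_zero_of_mul hx
  have hfin' : (Function.support fun S => μ.toFun P * (FinDist.dirac P).toFun S).Finite :=
    (FinDist.dirac P).finite_support.subset fun x hx => right_ne_zero_of_mul hx
  have hfin2 : (Function.support fun S => μ.toFun S +
      μ.toFun P * (FinDist.dirac Q).toFun S).Finite :=
    (μ.finite_support.union hfin).subset (Function.support_add _ _)
  have heq : (fun S => μ.toFun S + μ.toFun P * 1 *
      ((FinDist.dirac Q).toFun S - (if S = P then 1 else 0))) =
      fun S => (μ.toFun S + μ.toFun P * (FinDist.dirac Q).toFun S) -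
        μ.toFun P * (FinDist.dirac P).toFun S := by
    funext S
    rw [← FinDist.dirac_apply P S]; ring
  refine ⟨⟨fun S => μ.toFun S + μ.toFun P * 1 *
      ((FinDist.dirac Q).toFun S - (if S = P then 1 else 0)), ?_, ?_, ?_⟩, fun S => rfl⟩
  · intro S
    have h1 := μ.nonneg S
    have h2 := μ.nonneg P
    have h3 := (FinDist.dirac Q).nonneg S
    by_cases h : S = P
    · subst h
      have : (FinDist.dirac Q).toFun S = 0 := by rw [FinDist.dirac_apply, if_neg hPQ]
      simp [this]
    · simp only [h, if_false, sub_zero, mul_one]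
      positivity
  · rw [heq]
    exact (hfin2.union hfin').subset (Function.support_sub _ _)
  · rw [heq, finsum_sub_distrib hfin2 hfin', finsum_add_distrib μ.finite_support hfin,
      ← mul_finsum _ , ← mul_finsum _ , μ.sum_one, FinDist.sum_one, FinDist.sum_one]
    ring

theorem clear_one {P Q : Tm} (h : TauSeq P Q) (hQ : Q ∈ psiL) : ∀ μ : FinDist Tm,
    ∃ ν, Internal μ ν ∧ ∀ S, ν.toFun S ≠ 0 → S ∉ psiL → μ.toFun S ≠ 0 ∧ S ≠ P := by
  induction h using Relation.ReflTransGen.head_induction_on with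
  | refl =>
    intro μ
    exact ⟨μ, internal_refl _, fun S h1 h2 => ⟨h1, fun h => h2 (h ▸ hQ)⟩⟩
  | @head a c h1 _ ih =>
    intro μ
    by_cases hac : a = c
    · subst hac; exact ih μ
    by_cases hμ : μ.toFun a = 0
    · refine ⟨μ, internal_refl _, fun S hS1 hS2 => ⟨hS1, ?_⟩⟩
      rintro rfl
      exact hS1 hμ
    obtain ⟨μ1, hμ1⟩ := exists_move μ hac
    obtain ⟨ν, hν, hS⟩ := ih μ1
    refine ⟨ν, internal_head (p := 1) ⟨one_pos, le_rfl, a, _,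
      lt_of_le_of_ne (μ.nonneg a) (Ne.symm hμ), h1, hμ1⟩ hν, ?_⟩
    intro S hS1 hS2
    obtain ⟨hS3, hS4⟩ := hS S hS1 hS2
    rw [hμ1, FinDist.dirac_apply, if_neg hS4] at hS3
    by_cases hSa : S = a
    · subst hSa; simp at hS3
    · exact ⟨by simpa [hSa] using hS3, hSa⟩

theorem clear_all (n : ℕ) : ∀ μ : FinDist Tm,
    {S | μ.toFun S ≠ 0 ∧ S ∉ psiL}.ncard = n →
    (∀ S, μ.toFun S ≠ 0 → Observable S) →
    ∃ ν, Internal μ ν ∧ ∀ S, ν.toFun S ≠ 0 → S ∈ psiL := by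
  induction n using Nat.strong_induction_on with
  | _ n ih =>
    intro μ hn hobs
    by_cases hall : ∀ S, μ.toFun S ≠ 0 → S ∈ psiL
    · exact ⟨μ, internal_refl _, hall⟩
    push Not at hall
    obtain ⟨P, hP, hPpsi⟩ := hall
    obtain ⟨Q, hPQ, hQ⟩ := hobs P hP
    obtain ⟨ν, hν, hS⟩ := clear_one hPQ hQ μ
    have hfin : {S | μ.toFun S ≠ 0 ∧ S ∉ psiL}.Finite :=
      μ.finite_support.subset fun S h => h.1
    have hlt : {S | ν.toFun S ≠ 0 ∧ S ∉ psiL}.ncard < n := by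
      rw [← hn]
      apply Set.ncard_lt_ncard _ hfin
      refine ⟨fun S h => ⟨(hS S h.1 h.2).1, h.2⟩, fun hsub => ?_⟩
      have := hsub (show P ∈ {S | μ.toFun S ≠ 0 ∧ S ∉ psiL} from ⟨hP, hPpsi⟩)
      exact (hS P this.1 this.2).2 rfl
    obtain ⟨κ, h1, h2⟩ := ih _ hlt ν rfl (by
      intro S h
      by_cases hp : S ∈ psiL
      · exact ⟨S, Relation.ReflTransGen.refl, hp⟩
      · exact hobs S (hS S h hp).1)
    exact ⟨κ, internal_trans hν h1, h2⟩

/-- For every CCS process `P`: `χmay_𝓛(δ_P)` is `1` if `P⇓` and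
`0` otherwise, and `χfair_𝓛(δ_P)` is `1` if `P⇊` and `0` otherwise. -/
theorem classical_characteristics (P : Tm) (hP : P.IsCCS) :
    (Observable P → chiMayL (FinDist.dirac P) = 1) ∧
    (¬ Observable P → chiMayL (FinDist.dirac P) = 0) ∧
    (StronglyObservable P → chiFairL (FinDist.dirac P) = 1) ∧
    (¬ StronglyObservable P → chiFairL (FinDist.dirac P) = 0) := by
  have hN := hP.2
  refine ⟨?_, chiMay_eq_zero hN, ?_, ?_⟩
  · rintro ⟨Q, hPQ, hQ⟩
    refine chiMay_eq_one (internal_dirac hPQ) fun S hS => ?_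
    rw [FinDist.dirac_apply] at hS
    have : S = Q := by by_contra h; simp [h] at hS
    exact this ▸ hQ
  · intro hso
    have hone : ∀ ν, Internal (FinDist.dirac P) ν → chiMayL ν = 1 := by
      intro ν hν
      obtain ⟨κ, h1, h2⟩ := clear_all _ ν rfl fun S hS =>
        hso S (reach_internal hN (reach_dirac P) hν S hS)
      exact chiMay_eq_one h1 h2
    have : {x | ∃ ν, Internal (FinDist.dirac P) ν ∧ x = chiMayL ν} = {1} := by
      ext x
      constructor
      · rintro ⟨ν, hν, rfl⟩
        exact hone ν hν
      · rintro rfl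
        exact ⟨_, internal_refl _, (hone _ (internal_refl _)).symm⟩
    rw [chiFairL, this, csInf_singleton]
  · intro hso
    unfold StronglyObservable at hso
    push Not at hso
    obtain ⟨Q, hPQ, hQ⟩ := hso
    apply le_antisymm
    · apply csInf_le
      · refine ⟨0, ?_⟩
        rintro x ⟨ν, _, rfl⟩
        exact chiMay_nonneg ν
      · exact ⟨_, internal_dirac hPQ, (chiMay_eq_zero (tauSeq_noOplus hN hPQ) hQ).symm⟩
    · apply Real.sInf_nonneg
      rintro x ⟨ν, _, rfl⟩
      exact chiMay_nonneg ν
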